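/- arXiv:1608.08957 — 2 statements merged into one kernel-verified Lean document; each statement's English description precedes it below -/
import Mathlib

section
/- Let G be a finite connected simple graph that is k-regular, and let u ∈ (0, 1/2]. Then gon(G) ≥ min{ (h_u(G)/(k + h_u(G)))·|V(G)|, h(G)·u·|V(G)| }. -/
open SimpleGraph Finset

namespace GraphGonality

variable {V : Type*}

/-- The degree of a divisor: the sum of its values. -/
def degD [Fintype V] (D : V → ℤ) : ℤ := ∑ v, D v

/-- A divisor is effective if it is nonnegative at every vertex. -/
def Effective (D : V → ℤ) : Prop := ∀ v, 0 ≤ D v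

/-- The graph Laplacian applied to an integer vector. -/
def lapply (G : SimpleGraph V) [Fintype V] [DecidableEq V] [DecidableRel G.Adj]
    (x : V → ℤ) : V → ℤ :=
  fun v => (G.degree v : ℤ) * x v - ∑ w ∈ G.neighborFinset v, x w

/-- Two divisors are linearly equivalent if their difference lies in the image of the
Laplacian acting on `ℤ^V`. -/
def LinEquiv (G : SimpleGraph V) [Fintype V] [DecidableEq V] [DecidableRel G.Adj]
    (D D' : V → ℤ) : Prop :=
  ∃ x : V → ℤ, D - D' = lapply G x

/-- A divisor has positive rank if, for every vertex `v`, the divisor `D - 1_v` is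
linearly equivalent to an effective divisor. -/
def PosRank (G : SimpleGraph V) [Fintype V] [DecidableEq V] [DecidableRel G.Adj]
    (D : V → ℤ) : Prop :=
  ∀ v : V, ∃ E : V → ℤ, Effective E ∧
    LinEquiv G (fun w => D w - if w = v then 1 else 0) E

/-- The gonality of a graph: the smallest degree of a divisor of positive rank. -/
noncomputable def gonality (G : SimpleGraph V) [Fintype V] [DecidableEq V]
    [DecidableRel G.Adj] : ℤ :=
  sInf {d : ℤ | ∃ D : V → ℤ, PosRank G D ∧ degD D = d}

/-- The support of a divisor. -/
def suppD (D : V → ℤ) : Set V := {v | 0 < D v}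

/-- The edge boundary of a set of vertices: edges with exactly one endpoint in `U`. -/
def edgeBoundary (G : SimpleGraph V) (U : Set V) : Set (Sym2 V) :=
  {e | e ∈ G.edgeSet ∧ ∃ a b, e = s(a, b) ∧ a ∈ U ∧ b ∉ U}

/-- The Cheeger constant of a graph. -/
noncomputable def cheeger (G : SimpleGraph V) [Fintype V] : ℝ :=
  sInf {r : ℝ | ∃ U : Set V, U.Nonempty ∧ (U.ncard : ℝ) ≤ (Fintype.card V : ℝ) / 2 ∧
    r = (edgeBoundary G U).ncard / U.ncard}

/-- The `u`-Cheeger constant of a graph. -/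
noncomputable def cheegerU (G : SimpleGraph V) [Fintype V] (u : ℝ) : ℝ :=
  sInf {r : ℝ | ∃ U : Set V, U.Nonempty ∧ (U.ncard : ℝ) ≤ u * (Fintype.card V : ℝ) ∧
    r = (edgeBoundary G U).ncard / U.ncard}

/-- Every connected component of the induced subgraph on the complement of the support
of `D` has at most `u * |V|` vertices. -/
def ComponentsSmall (G : SimpleGraph V) [Fintype V] (D : V → ℤ) (u : ℝ) : Prop :=
  ∀ c : (G.induce (suppD D)ᶜ).ConnectedComponent,
    (c.supp.ncard : ℝ) ≤ u * (Fintype.card V : ℝ)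

/-- `B_u(G)`: the smallest degree of an effective divisor all of whose complementary
components have size at most `u * |V|`. -/
noncomputable def Bu (G : SimpleGraph V) [Fintype V] (u : ℝ) : ℤ :=
  sInf {d : ℤ | ∃ D : V → ℤ, Effective D ∧ ComponentsSmall G D u ∧ degD D = d}


lemma degD_sub [Fintype V] (D E : V → ℤ) : degD (D - E) = degD D - degD E := by
  simp [degD, Finset.sum_sub_distrib]

lemma Effective.degD_nonneg [Fintype V] {D : V → ℤ} (hD : Effective D) : 0 ≤ degD D :=
  Finset.sum_nonneg fun v _ => hD v

lemma forall_mem_of_preconnected_induce {G : SimpleGraph V} {S : Set V} (hS : (G.induce S).Preconnected)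
    {p : V → Prop} (hp : ∀ a ∈ S, ∀ b ∈ S, G.Adj a b → p a → p b) {v : V} (hv : v ∈ S)
    (hpv : p v) : ∀ w ∈ S, p w := by
  intro w hw
  obtain ⟨q⟩ := hS ⟨v, hv⟩ ⟨w, hw⟩
  have key : ∀ {a b : S}, (G.induce S).Walk a b → p a → p b := by
    intro a b q
    induction q with
    | nil => exact id
    | cons h _ ih => exact fun ha => ih (hp _ (Subtype.coe_prop _) _ (Subtype.coe_prop _) h ha)
  exact key q hpv

section Laplacian

variable [Fintype V] [DecidableEq V] (G : SimpleGraph V) [DecidableRel G.Adj]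

lemma lapply_eq_sum_sub (x : V → ℤ) (v : V) :
    lapply G x v = ∑ w ∈ G.neighborFinset v, (x v - x w) := by
  simp [lapply, Finset.sum_sub_distrib]

lemma lapply_add (x y : V → ℤ) : lapply G (x + y) = lapply G x + lapply G y := by
  ext v
  simp only [lapply, Pi.add_apply, Finset.sum_add_distrib]
  ring

lemma lapply_neg (x : V → ℤ) : lapply G (-x) = -lapply G x := by
  ext v
  simp only [lapply, Pi.neg_apply, Finset.sum_neg_distrib]
  ring

@[simp]
lemma lapply_zero : lapply G 0 = 0 := by
  ext v
  simp [lapply]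

lemma degD_lapply (x : V → ℤ) : degD (lapply G x) = 0 := by
  have hsum : ∀ f : V → V → ℤ, ∑ v, ∑ w ∈ G.neighborFinset v, f v w =
      ∑ v, ∑ w, if G.Adj v w then f v w else 0 := by
    intro f
    simp [neighborFinset_eq_filter, Finset.sum_filter]
  have hswap : ∑ v, ∑ w ∈ G.neighborFinset v, x v = ∑ v, ∑ w ∈ G.neighborFinset v, x w := by
    rw [hsum, hsum, Finset.sum_comm]
    simp only [G.adj_comm]
  simp only [degD, lapply_eq_sum_sub, Finset.sum_sub_distrib]
  rw [hswap, sub_self]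

variable {G} in
lemma LinEquiv.degD_eq {D E : V → ℤ} (h : LinEquiv G D E) : degD D = degD E := by
  obtain ⟨x, hx⟩ := h
  have := degD_lapply G x
  rw [← hx, degD_sub] at this
  linarith

variable {G} in
lemma LinEquiv.symm {D E : V → ℤ} (h : LinEquiv G D E) : LinEquiv G E D := by
  obtain ⟨x, hx⟩ := h
  exact ⟨-x, by rw [lapply_neg, ← hx]; ring⟩

variable {G} in
lemma LinEquiv.trans {D E F : V → ℤ} (h : LinEquiv G D E) (h' : LinEquiv G E F) :
    LinEquiv G D F := by
  obtain ⟨x, hx⟩ := h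
  obtain ⟨y, hy⟩ := h'
  exact ⟨x + y, by rw [lapply_add, ← hx, ← hy]; ring⟩

lemma linEquiv_sub_lapply (D x : V → ℤ) : LinEquiv G D (D - lapply G x) :=
  ⟨x, by ring⟩

/-- The indicator vector of a finite set of vertices. -/
def indicatorVec (U : Finset V) : V → ℤ := fun v => if v ∈ U then 1 else 0

lemma lapply_indicatorVec_of_mem {U : Finset V} {v : V} (hv : v ∈ U) :
    lapply G (indicatorVec U) v = #(G.neighborFinset v \ U) := by
  rw [lapply_eq_sum_sub, ← Finset.filter_notMem_eq_sdiff, Finset.card_filter]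
  push_cast
  refine Finset.sum_congr rfl fun w _ => ?_
  by_cases hw : w ∈ U <;> simp [indicatorVec, hv, hw]

lemma lapply_indicatorVec_of_notMem {U : Finset V} {v : V} (hv : v ∉ U) :
    lapply G (indicatorVec U) v = -#(G.neighborFinset v ∩ U) := by
  rw [lapply_eq_sum_sub, ← Finset.filter_mem_eq_inter, Finset.card_filter]
  push_cast
  rw [← Finset.sum_neg_distrib]
  refine Finset.sum_congr rfl fun w _ => ?_
  by_cases hw : w ∈ U <;> simp [indicatorVec, hv, hw]

/-- The part of `x` exceeding the level `t`. -/
def excess (x : V → ℤ) (t : ℤ) : V → ℤ := fun v => max (x v - t) 0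

lemma excess_eq_add_indicatorVec (x : V → ℤ) (t : ℤ) :
    excess x t = excess x (t + 1) + indicatorVec {v | t + 1 ≤ x v} := by
  ext v
  simp only [excess, indicatorVec, Pi.add_apply, Finset.mem_filter, Finset.mem_univ, true_and]
  split_ifs <;> omega

lemma lapply_excess_le {x : V → ℤ} {t : ℤ} {v : V} (h : t ≤ x v) :
    lapply G (excess x t) v ≤ lapply G x v := by
  simp only [lapply_eq_sum_sub]
  refine Finset.sum_le_sum fun w _ => ?_
  simp only [excess]
  omega

lemma lapply_excess_nonpos {x : V → ℤ} {t : ℤ} {v : V} (h : x v ≤ t) :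
    lapply G (excess x t) v ≤ 0 := by
  rw [lapply_eq_sum_sub]
  refine Finset.sum_nonpos fun w _ => ?_
  simp only [excess]
  omega

variable {G} in
lemma Effective.sub_lapply_excess {D x : V → ℤ} (hD : Effective D)
    (hx : Effective (D - lapply G x)) (t : ℤ) : Effective (D - lapply G (excess x t)) := by
  intro v
  have h1 := hD v
  have h2 := hx v
  simp only [Pi.sub_apply] at h2 ⊢
  rcases le_total t (x v) with h | h
  · linarith [lapply_excess_le G h]
  · linarith [lapply_excess_nonpos G h]

end Laplacian

section Firing

variable [Fintype V] [DecidableEq V] {G : SimpleGraph V} [DecidableRel G.Adj]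

lemma ncard_edgeBoundary_le (U : Finset V) :
    (edgeBoundary G (U : Set V)).ncard ≤ ∑ v ∈ U, #(G.neighborFinset v \ U) := by
  have hsub : edgeBoundary G (U : Set V) ⊆
      (U.biUnion fun v => (G.neighborFinset v \ U).image fun w => s(v, w) : Finset (Sym2 V)) := by
    rintro e ⟨he, a, b, rfl, ha, hb⟩
    simp only [Finset.coe_biUnion, Set.mem_iUnion, Finset.mem_coe, Finset.mem_image]
    exact ⟨a, ha, b, by simpa using ⟨he, hb⟩, rfl⟩
  calc (edgeBoundary G (U : Set V)).ncard
      ≤ #(U.biUnion fun v => (G.neighborFinset v \ U).image fun w => s(v, w)) := by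
        rw [← Set.ncard_coe_finset]
        exact Set.ncard_le_ncard hsub (Finset.finite_toSet _)
    _ ≤ ∑ v ∈ U, #((G.neighborFinset v \ U).image fun w => s(v, w)) := Finset.card_biUnion_le
    _ ≤ ∑ v ∈ U, #(G.neighborFinset v \ U) := Finset.sum_le_sum fun v _ => Finset.card_image_le

/-- Firing `U` between effective divisors moves a chip along every boundary edge of `U`. -/
lemma ncard_edgeBoundary_le_degD {D : V → ℤ} {U : Finset V} (hD : Effective D)
    (hD' : Effective (D - lapply G (indicatorVec U))) :
    ((edgeBoundary G (U : Set V)).ncard : ℤ) ≤ degD D := by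
  calc ((edgeBoundary G (U : Set V)).ncard : ℤ)
      ≤ ∑ v ∈ U, (#(G.neighborFinset v \ U) : ℤ) := by exact_mod_cast ncard_edgeBoundary_le U
    _ ≤ ∑ v ∈ U, D v := by
        refine Finset.sum_le_sum fun v hv => ?_
        have := hD' v
        rw [Pi.sub_apply, lapply_indicatorVec_of_mem G hv] at this
        linarith
    _ ≤ degD D := Finset.sum_le_sum_of_subset_of_nonneg (Finset.subset_univ U) fun v _ _ => hD v

lemma disjoint_of_fire {D : V → ℤ} {U : Finset V}
    (hD' : Effective (D - lapply G (indicatorVec U))) {S : Set V}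
    (hS : (G.induce S).Preconnected) (hDS : ∀ v ∈ S, D v ≤ 0) {v : V} (hv : v ∈ S)
    (hvU : v ∉ U) : ∀ w ∈ S, w ∉ U := by
  refine forall_mem_of_preconnected_induce hS (fun a _ b hb hab ha hbU => ?_) hv hvU
  have h := hD' b
  rw [Pi.sub_apply, lapply_indicatorVec_of_mem G hbU] at h
  have hcard : 0 < #(G.neighborFinset b \ U) :=
    Finset.card_pos.mpr ⟨a, by simpa using ⟨hab.symm, ha⟩⟩
  have := hDS b hb
  omega

lemma subset_of_fire {D : V → ℤ} {U : Finset V} (hD : Effective D) {S : Set V}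
    (hS : (G.induce S).Preconnected) (hDS : ∀ v ∈ S, (D - lapply G (indicatorVec U)) v ≤ 0)
    {v : V} (hv : v ∈ S) (hvD : 0 < D v) : ∀ w ∈ S, w ∈ U := by
  have hvU : v ∈ U := by
    by_contra hvU
    have h := hDS v hv
    rw [Pi.sub_apply, lapply_indicatorVec_of_notMem G hvU] at h
    omega
  refine forall_mem_of_preconnected_induce hS (fun a _ b hb hab ha => ?_) hv hvU
  by_contra hbU
  have h := hDS b hb
  rw [Pi.sub_apply, lapply_indicatorVec_of_notMem G hbU] at h
  have hcard : 0 < #(G.neighborFinset b ∩ U) :=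
    Finset.card_pos.mpr ⟨a, by simpa using ⟨hab.symm, ha⟩⟩
  have := hD b
  omega

end Firing

section Scramble

variable [Fintype V] [DecidableEq V] {G : SimpleGraph V} [DecidableRel G.Adj]

/-- Moving chips from `D` to a linearly equivalent effective divisor with a chip on `S`, the
first divisor on the way with a chip on `S` either still meets every connected set that `D`
meets, or the way there crosses a set separating `S` from one of them. -/
lemma exists_hitting_or_separating {D : V → ℤ} (hD : Effective D) {S : Set V}
    (hS : (G.induce S).Preconnected) (hDS : ∀ v ∈ S, D v ≤ 0) {D' : V → ℤ}
    (hD' : Effective D') (hDD' : LinEquiv G D D') {v : V} (hv : v ∈ S) (hvD' : 0 < D' v)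
    (P : Set (Set V)) (hP : ∀ T ∈ P, (G.induce T).Preconnected) :
    (∃ F, Effective F ∧ LinEquiv G D F ∧ (∃ w ∈ S, 0 < F w) ∧
      ∀ T ∈ P, (∃ w ∈ T, 0 < D w) → ∃ w ∈ T, 0 < F w) ∨
    ∃ T ∈ P, ∃ U : Finset V, T ⊆ U ∧ S ⊆ (U : Set V)ᶜ ∧
      ((edgeBoundary G (U : Set V)).ncard : ℤ) ≤ degD D := by
  obtain ⟨x, hx⟩ := hDD'
  obtain rfl : D' = D - lapply G x := by rw [← hx]; ring
  let F : ℤ → V → ℤ := fun t => D - lapply G (excess x t)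
  have hF : ∀ t, Effective (F t) := hD.sub_lapply_excess hD'
  have hDF : ∀ t, LinEquiv G D (F t) := fun t => linEquiv_sub_lapply G D _
  have hstep : ∀ t, F t = F (t + 1) - lapply G (indicatorVec {v | t + 1 ≤ x v}) := by
    intro t
    simp only [F]
    rw [excess_eq_add_indicatorVec, lapply_add]
    ring
  obtain ⟨M, hM⟩ : ∃ M, ∀ w, x w ≤ M := by
    obtain ⟨M, hM⟩ := (Set.finite_range x).bddAbove
    exact ⟨M, fun w => hM ⟨w, rfl⟩⟩
  have hlarge : ∀ t, M ≤ t → F t = D := by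
    intro t ht
    have : excess x t = 0 := by
      ext w
      have := hM w
      simp only [excess, Pi.zero_apply]
      omega
    simp [F, this]
  have hFv : 0 < F (x v) v := by
    have := lapply_excess_le G (le_refl (x v))
    simp only [F, Pi.sub_apply] at hvD' ⊢
    linarith
  obtain ⟨t₀, ht₀, ht₀_max⟩ := Int.exists_greatest_of_bdd (P := fun t => ∃ w ∈ S, 0 < F t w)
    ⟨M, by
      rintro t ⟨w, hw, hwt⟩
      by_contra! h
      rw [hlarge t h.le] at hwt
      exact absurd hwt (hDS w hw).not_gt⟩ ⟨x v, v, hv, hFv⟩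
  have hxt₀ : x v ≤ t₀ := ht₀_max _ ⟨v, hv, hFv⟩
  by_cases hall : ∀ T ∈ P, (∃ w ∈ T, 0 < D w) → ∃ w ∈ T, 0 < F t₀ w
  · exact Or.inl ⟨F t₀, hF t₀, hDF t₀, ht₀, hall⟩
  right
  push Not at hall
  obtain ⟨T, hTP, ⟨z, hz, hzD⟩, hT⟩ := hall
  obtain ⟨t, ht, ht_max⟩ := Int.exists_greatest_of_bdd (P := fun t => ∀ w ∈ T, F t w ≤ 0)
    ⟨M, by
      intro t ht
      by_contra! h
      have := ht z hz
      rw [hlarge t h.le] at this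
      exact absurd hzD this.not_gt⟩ ⟨t₀, hT⟩
  have ht₀t : t₀ ≤ t := ht_max _ hT
  have hnext : ∃ w ∈ T, 0 < F (t + 1) w := by
    by_contra! h
    have := ht_max _ h
    omega
  obtain ⟨w, hw, hwt⟩ := hnext
  rw [hstep t] at ht
  have hfire := hF t
  rw [hstep t] at hfire
  refine ⟨T, hTP, _, subset_of_fire (hF (t + 1)) (hP T hTP) ht hw hwt,
    disjoint_of_fire hfire hS (fun a ha => ?_) hv ?_, ?_⟩
  · by_contra! h
    have := ht₀_max _ ⟨a, ha, h⟩
    omega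
  · simp only [Finset.mem_filter, Finset.mem_univ, true_and]
    omega
  · rw [(hDF (t + 1)).degD_eq]
    exact ncard_edgeBoundary_le_degD (hF (t + 1)) hfire

variable (G) in
/-- A divisor of positive rank is equivalent to an effective one meeting every set of a family
of nonempty connected sets, unless its degree bounds a cut between two sets of the family. -/
lemma PosRank.exists_hitting_or_separating [Nonempty V] {D : V → ℤ} (hD : PosRank G D)
    (P : Set (Set V)) (hP : ∀ T ∈ P, (G.induce T).Connected) :
    (∃ F, Effective F ∧ LinEquiv G D F ∧ ∀ T ∈ P, ∃ w ∈ T, 0 < F w) ∨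
    ∃ S ∈ P, ∃ T ∈ P, ∃ U : Finset V, T ⊆ U ∧ S ⊆ (U : Set V)ᶜ ∧
      ((edgeBoundary G (U : Set V)).ncard : ℤ) ≤ degD D := by
  have hhit : ∀ v, ∃ F, Effective F ∧ LinEquiv G D F ∧ 0 < F v := by
    intro v
    obtain ⟨E, hE, x, hx⟩ := hD v
    refine ⟨E + fun w => if w = v then 1 else 0, fun w => ?_, ⟨x, ?_⟩, ?_⟩
    · have := hE w
      simp only [Pi.add_apply]
      split_ifs <;> omega
    · rw [← hx]
      ext w
      simp only [Pi.sub_apply, Pi.add_apply]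
      ring
    · have := hE v
      simp only [Pi.add_apply, if_true]
      omega
  let unhit : (V → ℤ) → Set (Set V) := fun F => {T | T ∈ P ∧ ∀ w ∈ T, F w ≤ 0}
  obtain ⟨F, ⟨hF, hDF⟩, hmin⟩ := exists_minimalFor_of_wellFoundedLT
    (fun F => Effective F ∧ LinEquiv G D F) unhit
    (by obtain ⟨F, hF, hDF, -⟩ := hhit (Classical.arbitrary V); exact ⟨F, hF, hDF⟩)
  by_cases hall : ∀ T ∈ P, ∃ w ∈ T, 0 < F w
  · exact Or.inl ⟨F, hF, hDF, hall⟩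
  right
  push Not at hall
  obtain ⟨S, hS, hFS⟩ := hall
  obtain ⟨⟨v, hv⟩⟩ := (hP S hS).nonempty
  obtain ⟨F', hF', hDF', hvF'⟩ := hhit v
  rcases GraphGonality.exists_hitting_or_separating hF (hP S hS).preconnected hFS hF'
    (hDF.symm.trans hDF') hv hvF' P (fun T hT => (hP T hT).preconnected) with
    ⟨E, hE, hFE, ⟨a, ha, haE⟩, hEP⟩ | h
  · have hle : unhit E ≤ unhit F := by
      rintro T ⟨hT, hTE⟩
      refine ⟨hT, ?_⟩
      by_contra! h
      obtain ⟨w, hw, hwE⟩ := hEP T hT h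
      exact absurd hwE (hTE w hw).not_gt
    exact absurd haE ((hmin ⟨hE, hDF.trans hFE⟩ hle ⟨hS, hFS⟩).2 a ha).not_gt
  · rw [hDF.degD_eq]
    exact ⟨S, hS, h⟩

end Scramble

section Components

lemma connected_induce_image_supp (G : SimpleGraph V) {A : Set V}
    (c : (G.induce A).ConnectedComponent) :
    (G.induce (Subtype.val '' c.supp)).Connected := by
  let f : c.toSimpleGraph →g G.induce (Subtype.val '' c.supp) :=
    { toFun := fun a => ⟨a.1.1, a.1, a.2, rfl⟩
      map_rel' := fun h => h }
  refine c.connected_toSimpleGraph.map f ?_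
  rintro ⟨_, a, ha, rfl⟩
  exact ⟨⟨a, ha⟩, rfl⟩

variable [Fintype V] [DecidableEq V] {G : SimpleGraph V} [DecidableRel G.Adj]

/-- If every small set has boundary at least `h` times its size, and the components of the
complement of the support are small, then the support is large. -/
lemma ComponentsSmall.mul_card_le {k : ℕ} (hreg : G.IsRegularOfDegree k) {D : V → ℤ} {u h : ℝ}
    (hD : ComponentsSmall G D u)
    (hh : ∀ U : Finset V, U.Nonempty → (#U : ℝ) ≤ u * Fintype.card V →
      h * #U ≤ (edgeBoundary G (U : Set V)).ncard) :
    h * #{v | ¬ 0 < D v} ≤ k * #{v | 0 < D v} := by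
  classical
  let A : Set V := (suppD D)ᶜ
  let H := G.induce A
  let U : H.ConnectedComponent → Finset V := fun c =>
    ({a : A | H.connectedComponentMk a = c} : Finset A).map (Function.Embedding.subtype _)
  have hU : ∀ c, (U c : Set V) = Subtype.val '' c.supp := by
    intro c
    ext v
    simp [U, H]
  have hUle : ∀ c, h * #(U c) ≤ ∑ v ∈ U c, (#(G.neighborFinset v ∩ ({w | 0 < D w} : Finset V)) : ℝ) := by
    intro c
    have hne : (U c).Nonempty := by
      rw [← Finset.coe_nonempty, hU]
      exact c.nonempty_supp.image _
    have hsmall : (#(U c) : ℝ) ≤ u * Fintype.card V := by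
      rw [← Set.ncard_coe_finset, hU, Set.ncard_image_of_injective _ Subtype.val_injective]
      exact hD c
    refine (hh _ hne hsmall).trans ?_
    refine (Nat.cast_le.mpr (ncard_edgeBoundary_le (U c))).trans ?_
    push_cast
    refine Finset.sum_le_sum fun v hv => Nat.cast_le.mpr (Finset.card_le_card fun w hw => ?_)
    simp only [Finset.mem_sdiff, mem_neighborFinset, Finset.mem_inter, Finset.mem_filter,
      Finset.mem_univ, true_and] at hw ⊢
    refine ⟨hw.1, ?_⟩
    by_contra hwD
    rw [← Finset.mem_coe, hU] at hv
    obtain ⟨a, ha, rfl⟩ := hv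
    refine hw.2 ?_
    rw [← Finset.mem_coe, hU]
    exact ⟨⟨w, hwD⟩, c.mem_supp_of_adj_mem_supp ha hw.1, rfl⟩
  have hsum : ∀ f : V → ℝ, ∑ c, ∑ v ∈ U c, f v = ∑ v with ¬ 0 < D v, f v := by
    intro f
    simp only [U, Finset.sum_map, Function.Embedding.subtype_apply]
    refine (Finset.sum_fiberwise univ H.connectedComponentMk fun a : A => f a).trans ?_
    exact (Finset.sum_subtype _ (by simp [A, suppD]) f).symm
  calc h * (#{v | ¬ 0 < D v} : ℝ)
      = ∑ c, h * (#(U c) : ℝ) := by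
        rw [← Finset.mul_sum, Finset.cast_card, ← hsum]
        simp
    _ ≤ ∑ v with ¬ 0 < D v, (#(G.neighborFinset v ∩ ({w | 0 < D w} : Finset V)) : ℝ) := by
        rw [← hsum]
        exact Finset.sum_le_sum fun c _ => hUle c
    _ = ∑ w with 0 < D w, (#(G.neighborFinset w ∩ ({v | ¬ 0 < D v} : Finset V)) : ℝ) := by
        have := Finset.sum_card_bipartiteAbove_eq_sum_card_bipartiteBelow G.Adj
          (s := {v | ¬ 0 < D v}) (t := {w | 0 < D w})
        have h1 : ∀ v (B : Finset V), G.neighborFinset v ∩ B = B.filter (G.Adj v) := by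
          intro v B
          ext w
          simp [and_comm]
        simp only [h1, Finset.bipartiteAbove, Finset.bipartiteBelow, G.adj_comm] at this ⊢
        exact_mod_cast this
    _ ≤ ∑ w with 0 < D w, (k : ℝ) := by
        refine Finset.sum_le_sum fun w _ => Nat.cast_le.mpr ?_
        exact (Finset.card_le_card Finset.inter_subset_left).trans (hreg w).le
    _ = k * #{v | 0 < D v} := by simp [mul_comm]

end Components

section Cheeger

lemma edgeBoundary_compl (G : SimpleGraph V) (U : Set V) :
    edgeBoundary G Uᶜ = edgeBoundary G U := by
  ext e
  constructor
  · rintro ⟨he, a, b, rfl, ha, hb⟩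
    exact ⟨he, b, a, Sym2.eq_swap, by simpa using hb, ha⟩
  · rintro ⟨he, a, b, rfl, ha, hb⟩
    exact ⟨he, b, a, Sym2.eq_swap, hb, by simpa using ha⟩

variable [Fintype V] (G : SimpleGraph V)

lemma cheegerU_nonneg (u : ℝ) : 0 ≤ cheegerU G u := by
  refine Real.sInf_nonneg ?_
  rintro r ⟨U, -, -, rfl⟩
  positivity

lemma cheegerU_mul_le (u : ℝ) {U : Set V} (hU : U.Nonempty)
    (hUu : (U.ncard : ℝ) ≤ u * Fintype.card V) :
    cheegerU G u * U.ncard ≤ (edgeBoundary G U).ncard := by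
  have hpos : (0 : ℝ) < U.ncard := by exact_mod_cast hU.ncard_pos
  rw [← le_div_iff₀ hpos]
  refine csInf_le ⟨0, ?_⟩ ⟨U, hU, hUu, rfl⟩
  rintro r ⟨U, -, -, rfl⟩
  positivity

lemma cheeger_eq_cheegerU : cheeger G = cheegerU G (1 / 2) := by
  simp only [cheeger, cheegerU, one_div, inv_mul_eq_div]

/-- A cut both of whose sides have at least `m` vertices has at least `h(G) m` edges. -/
lemma cheeger_mul_le {U : Set V} {m : ℝ} (hm : 0 < m) (hU : m ≤ U.ncard)
    (hU' : m ≤ (Uᶜ).ncard) : cheeger G * m ≤ (edgeBoundary G U).ncard := by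
  have key : ∀ W : Set V, m ≤ W.ncard → (W.ncard : ℝ) ≤ 1 / 2 * Fintype.card V →
      cheeger G * m ≤ (edgeBoundary G W).ncard := by
    intro W hmW hW
    have hne : W.Nonempty := by
      rw [Set.nonempty_iff_ne_empty]
      rintro rfl
      simp only [Set.ncard_empty, Nat.cast_zero] at hmW
      linarith
    rw [cheeger_eq_cheegerU]
    exact (mul_le_mul_of_nonneg_left hmW (cheegerU_nonneg G _)).trans
      (cheegerU_mul_le G _ hne hW)
  have hcard : (U.ncard : ℝ) + (Uᶜ).ncard = Fintype.card V := by
    rw [← Nat.card_eq_fintype_card]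
    exact_mod_cast Set.ncard_add_ncard_compl U
  rcases le_total (U.ncard : ℝ) (1 / 2 * Fintype.card V) with h | h
  · exact key U hU h
  · rw [← edgeBoundary_compl]
    exact key Uᶜ hU' (by linarith)

end Cheeger

lemma exists_posRank_degD_eq_gonality [Fintype V] [DecidableEq V] [Nonempty V]
    (G : SimpleGraph V) [DecidableRel G.Adj] : ∃ D, PosRank G D ∧ degD D = gonality G := by
  refine Int.csInf_mem (s := {d : ℤ | ∃ D : V → ℤ, PosRank G D ∧ degD D = d})
    ⟨_, fun _ => 1, fun v => ⟨fun w => 1 - if w = v then 1 else 0, fun w => ?_, 0, ?_⟩, rfl⟩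
    ⟨0, ?_⟩
  · dsimp only
    split_ifs <;> norm_num
  · simp
  · rintro d ⟨D, hD, rfl⟩
    obtain ⟨E, hE, h⟩ := hD (Classical.arbitrary V)
    have := h.degD_eq
    have hE' := hE.degD_nonneg
    have : degD (fun w => D w - if w = Classical.arbitrary V then 1 else 0) = degD D - 1 := by
      simp [degD, Finset.sum_sub_distrib]
    omega

/-- Theorem 3 (Cheeger bound): for a `k`-regular finite connected simple graph `G` and
`u ∈ (0, 1/2]`, `gon(G) ≥ min { (h_u(G)/(k + h_u(G))) |V(G)|, h(G) u |V(G)| }`. -/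
theorem gonality_ge_min_cheegerU {V : Type*} [Fintype V] [DecidableEq V]
    (G : SimpleGraph V) [DecidableRel G.Adj] (hG : G.Connected)
    (k : ℕ) (hreg : G.IsRegularOfDegree k) (u : ℝ) (hu0 : 0 < u) (hu : u ≤ 1 / 2) :
    min (cheegerU G u / ((k : ℝ) + cheegerU G u) * (Fintype.card V : ℝ))
        (cheeger G * (u * (Fintype.card V : ℝ))) ≤ (gonality G : ℝ) := by
  have hne : Nonempty V := hG.nonempty
  obtain ⟨D, hD, hdeg⟩ := exists_posRank_degD_eq_gonality G
  have hn : (0 : ℝ) < Fintype.card V := by exact_mod_cast Fintype.card_pos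
  rw [← hdeg]
  rcases PosRank.exists_hitting_or_separating G hD
    {T | (G.induce T).Connected ∧ u * Fintype.card V < T.ncard} (fun T hT => hT.1) with
    ⟨F, hF, hDF, hhit⟩ | ⟨S, hS, T, hT, U, hTU, hSU, hcut⟩
  · refine min_le_of_left_le ?_
    have hsmall : ComponentsSmall G F u := by
      intro c
      by_contra! hc
      obtain ⟨_, ⟨a, -, rfl⟩, ha⟩ := hhit (Subtype.val '' c.supp)
        ⟨connected_induce_image_supp G c, by
          rwa [Set.ncard_image_of_injective _ Subtype.val_injective]⟩
      exact a.2 ha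
    have hcount := hsmall.mul_card_le hreg (h := cheegerU G u) fun W hW hWu => by
      have := cheegerU_mul_le G u (U := (W : Set V)) (by simpa using hW)
        (by rwa [Set.ncard_coe_finset])
      rwa [Set.ncard_coe_finset] at this
    have hcard : (#{v | 0 < F v} : ℝ) + #{v | ¬ 0 < F v} = Fintype.card V := by
      exact_mod_cast Finset.card_filter_add_card_filter_not (s := Finset.univ) (0 < F ·)
    have hsupp : (#{v | 0 < F v} : ℝ) ≤ degD D := by
      rw [hDF.degD_eq, Finset.card_filter]
      have : ∑ v, (if 0 < F v then 1 else 0) ≤ degD F := by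
        refine Finset.sum_le_sum fun v _ => ?_
        have := hF v
        split_ifs <;> omega
      exact_mod_cast this
    have hnonneg := cheegerU_nonneg G u
    rcases (add_nonneg k.cast_nonneg hnonneg : 0 ≤ (k : ℝ) + cheegerU G u).eq_or_lt with h0 | h0
    · rw [← h0, div_zero, zero_mul]
      exact le_trans (Nat.cast_nonneg _) hsupp
    · refine le_trans ?_ hsupp
      rw [div_mul_eq_mul_div, div_le_iff₀ h0, ← hcard]
      linarith
  · refine min_le_of_right_le ?_
    refine (cheeger_mul_le G (U := (U : Set V)) (by positivity) (hT.2.le.trans ?_)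
      (hS.2.le.trans ?_)).trans (by exact_mod_cast hcut)
    · exact_mod_cast Set.ncard_le_ncard hTU (Set.toFinite _)
    · exact_mod_cast Set.ncard_le_ncard hSU (Set.toFinite _)

end GraphGonality
end

section
/- Let G be a finite connected simple 3-regular graph on n vertices, with genus g = n/2 + 1 and independence number α(G). Then n − α(G) < g if and only if G is bipartite, and in that case n − α(G) = g − 1. -/
open SimpleGraph Finset

namespace GraphGonality

variable {V : Type*}

/-- A set of vertices is independent if no two of its vertices are adjacent. -/
def IndepSet (G : SimpleGraph V) (S : Set V) : Prop := ∀ a ∈ S, ∀ b ∈ S, ¬ G.Adj a b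

/-- The independence number: the largest size of an independent set of vertices. -/
noncomputable def indepNum (G : SimpleGraph V) [Fintype V] : ℕ :=
  sSup {n : ℕ | ∃ S : Set V, IndepSet G S ∧ S.ncard = n}

/-- A graph is bipartite if its vertex set can be partitioned into two independent sets. -/
def Bipartite (G : SimpleGraph V) : Prop := ∃ S : Set V, IndepSet G S ∧ IndepSet G Sᶜ

theorem IndepSet.ncard_le_indepNum [Fintype V] {G : SimpleGraph V} {S : Set V}
    (hS : IndepSet G S) : S.ncard ≤ indepNum G :=
  le_csSup ⟨Nat.card V, by rintro _ ⟨T, -, rfl⟩; exact Set.ncard_le_card T⟩ ⟨S, hS, rfl⟩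

theorem exists_indepSet_ncard_eq_indepNum [Fintype V] (G : SimpleGraph V) :
    ∃ S : Set V, IndepSet G S ∧ S.ncard = indepNum G := by
  refine Nat.sSup_mem (s := {n : ℕ | ∃ S : Set V, IndepSet G S ∧ S.ncard = n})
    ⟨0, ∅, by simp [IndepSet], by simp⟩ ⟨Nat.card V, ?_⟩
  rintro _ ⟨T, -, rfl⟩
  exact Set.ncard_le_card T

theorem card_filter_adj_add_card_filter_adj_compl [Fintype V] [DecidableEq V]
    (G : SimpleGraph V) [DecidableRel G.Adj] (S : Finset V) (v : V) :
    #{w ∈ S | G.Adj v w} + #{w ∈ Sᶜ | G.Adj v w} = G.degree v := by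
  rw [← card_union_of_disjoint (disjoint_filter_filter disjoint_compl_right), ← filter_union,
    union_compl, ← G.card_neighborFinset_eq_degree, G.neighborFinset_eq_filter]

/-- In a regular graph, counting the edges that leave an independent set from both sides. -/
theorem IndepSet.mul_card_add_sum_card_filter_adj_compl [Fintype V] [DecidableEq V]
    {G : SimpleGraph V} [DecidableRel G.Adj] {k : ℕ} (hreg : G.IsRegularOfDegree k)
    {S : Finset V} (hS : IndepSet G S) :
    k * #S + ∑ v ∈ Sᶜ, #{w ∈ Sᶜ | G.Adj v w} = k * #Sᶜ := by
  have hdeg (v : V) := (card_filter_adj_add_card_filter_adj_compl G S v).trans (hreg.degree_eq v)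
  have hin : ∑ v ∈ S, #{w ∈ Sᶜ | G.Adj v w} = k * #S := by
    rw [mul_comm, ← smul_eq_mul, ← sum_const]
    refine sum_congr rfl fun v hv => ?_
    rw [← hdeg v, filter_false_of_mem fun w hw => hS v hv w hw, card_empty, zero_add]
  have hswap : ∑ v ∈ S, #{w ∈ Sᶜ | G.Adj v w} = ∑ v ∈ Sᶜ, #{w ∈ S | G.Adj v w} := by
    simpa only [bipartiteAbove, bipartiteBelow, G.adj_comm] using
      sum_card_bipartiteAbove_eq_sum_card_bipartiteBelow (s := S) (t := Sᶜ) G.Adj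
  rw [← hin, hswap, ← sum_add_distrib, sum_congr rfl fun v _ => hdeg v, sum_const, smul_eq_mul,
    mul_comm]

theorem IndepSet.card_le_card_compl [Fintype V] [DecidableEq V] {G : SimpleGraph V}
    [DecidableRel G.Adj] {k : ℕ} (hk : 0 < k) (hreg : G.IsRegularOfDegree k) {S : Finset V}
    (hS : IndepSet G S) : #S ≤ #Sᶜ :=
  Nat.le_of_mul_le_mul_left
    (hS.mul_card_add_sum_card_filter_adj_compl hreg ▸ Nat.le_add_right _ _) hk

theorem IndepSet.card_eq_card_compl_iff [Fintype V] [DecidableEq V] {G : SimpleGraph V}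
    [DecidableRel G.Adj] {k : ℕ} (hk : 0 < k) (hreg : G.IsRegularOfDegree k) {S : Finset V}
    (hS : IndepSet G S) : #S = #Sᶜ ↔ IndepSet G (S : Set V)ᶜ := by
  rw [← Nat.mul_right_inj hk.ne', ← hS.mul_card_add_sum_card_filter_adj_compl hreg]
  simp [IndepSet, filter_eq_empty_iff]

theorem IndepSet.two_mul_ncard_le_card [Fintype V] {G : SimpleGraph V} [DecidableRel G.Adj]
    {k : ℕ} (hk : 0 < k) (hreg : G.IsRegularOfDegree k) {S : Set V} (hS : IndepSet G S) :
    2 * S.ncard ≤ Fintype.card V := by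
  classical
  lift S to Finset V using S.toFinite
  have := hS.card_le_card_compl hk hreg
  have := S.card_add_card_compl
  rw [Set.ncard_coe_finset]
  omega

theorem IndepSet.two_mul_ncard_eq_card_iff [Fintype V] {G : SimpleGraph V} [DecidableRel G.Adj]
    {k : ℕ} (hk : 0 < k) (hreg : G.IsRegularOfDegree k) {S : Set V} (hS : IndepSet G S) :
    2 * S.ncard = Fintype.card V ↔ IndepSet G Sᶜ := by
  classical
  lift S to Finset V using S.toFinite
  rw [← hS.card_eq_card_compl_iff hk hreg, Set.ncard_coe_finset, ← S.card_add_card_compl]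
  omega

/-- A regular graph of positive degree is bipartite exactly when its independence number attains
the upper bound of half the number of vertices. -/
theorem bipartite_iff_two_mul_indepNum_eq_card [Fintype V] {G : SimpleGraph V}
    [DecidableRel G.Adj] {k : ℕ} (hk : 0 < k) (hreg : G.IsRegularOfDegree k) :
    Bipartite G ↔ 2 * indepNum G = Fintype.card V := by
  obtain ⟨T, hT, hTcard⟩ := exists_indepSet_ncard_eq_indepNum G
  constructor
  · rintro ⟨S, hS, hSc⟩
    have := (hS.two_mul_ncard_eq_card_iff hk hreg).2 hSc
    have := hS.ncard_le_indepNum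
    have := hT.two_mul_ncard_le_card hk hreg
    omega
  · intro h
    exact ⟨T, hT, (hT.two_mul_ncard_eq_card_iff hk hreg).1 (hTcard ▸ h)⟩

/-- For a 3-regular finite connected simple graph on `n` vertices with genus
`g = |E(G)| − n + 1` (which equals `n/2 + 1`), one has `n − α(G) < g` if and only if `G`
is bipartite, in which case `n − α(G) = g − 1`. -/
theorem card_sub_indepNum_lt_genus_iff_bipartite {V : Type*} [Fintype V] [DecidableEq V]
    (G : SimpleGraph V) [DecidableRel G.Adj] (hG : G.Connected)
    (hreg : G.IsRegularOfDegree 3)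
    (n : ℕ) (hn : Fintype.card V = n)
    (g : ℤ) (hg : g = (G.edgeFinset.card : ℤ) - (n : ℤ) + 1) :
    ((n : ℤ) - (indepNum G : ℤ) < g ↔ Bipartite G) ∧
      (Bipartite G → (n : ℤ) - (indepNum G : ℤ) = g - 1) := by
  have hedges : 3 * n = 2 * #G.edgeFinset := by
    rw [← G.sum_degrees_eq_twice_card_edges, sum_congr rfl fun v _ => hreg.degree_eq v, sum_const,
      card_univ, hn, smul_eq_mul, mul_comm]
  obtain ⟨T, hT, hTcard⟩ := exists_indepSet_ncard_eq_indepNum G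
  have hle := hT.two_mul_ncard_le_card three_pos hreg
  rw [bipartite_iff_two_mul_indepNum_eq_card three_pos hreg]
  omega

end GraphGonality
end
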